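/- arXiv:2107.03715 — 3 statements merged into one kernel-verified Lean document; each statement's English description precedes it below -/
import Mathlib

section
/- For all positive integers g and m, the function ξ(x) = 1/cosh x satisfies, for all x ∈ ℝ, the equation ξ''(x) − (m−1) tanh x·ξ'(x) − m tanh²x·ξ(x) + (λ + m − 2m/g)·ξ(x)/cosh²x = 0 with λ = 2m/g − m + 1. -/
open Real

theorem hasDerivAt_one_div_cosh (x : ℝ) :
    HasDerivAt (fun y : ℝ => 1 / cosh y) (-sinh x / cosh x ^ 2) x := by
  simpa only [one_div] using (hasDerivAt_cosh x).fun_inv (cosh_pos x).ne'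

theorem hasDerivAt_neg_sinh_div_cosh_sq (x : ℝ) :
    HasDerivAt (fun y : ℝ => -sinh y / cosh y ^ 2)
      (-1 / cosh x + 2 * sinh x ^ 2 / cosh x ^ 3) x := by
  have hc : cosh x ≠ 0 := (cosh_pos x).ne'
  refine ((hasDerivAt_sinh x).fun_neg.fun_div ((hasDerivAt_cosh x).fun_pow 2)
    (pow_ne_zero 2 hc)).congr_deriv ?_
  field_simp
  ring

/-- The function `ξ(x) = 1/cosh x` is an eigenfunction of the Jacobi operator of the
harmonic self-map of the sphere associated with `r(t) = (1-g)t`, with eigenvalue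
`λ = 2m/g - m + 1`. -/
theorem first_eigenfunction_sphere_linear (g m : ℕ) (hg : 0 < g) (hm : 0 < m) (lam : ℝ)
    (hlam : lam = 2 * (m : ℝ) / g - m + 1)
    (ξ : ℝ → ℝ) (hξ : ξ = fun x : ℝ => 1 / cosh x) :
    ∀ x : ℝ,
      deriv (deriv ξ) x
      - ((m : ℝ) - 1) * tanh x * deriv ξ x
      - (m : ℝ) * tanh x ^ 2 * ξ x
      + (lam + (m : ℝ) - 2 * (m : ℝ) / g) * ξ x / cosh x ^ 2 = 0 := by
  intro x
  have hderiv : deriv ξ = fun y : ℝ => -sinh y / cosh y ^ 2 := by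
    subst hξ
    exact funext fun y => (hasDerivAt_one_div_cosh y).deriv
  have hcoef : lam + (m : ℝ) - 2 * (m : ℝ) / g = 1 := by
    rw [hlam]
    ring
  have hc : cosh x ≠ 0 := (cosh_pos x).ne'
  rw [hcoef, hderiv, (hasDerivAt_neg_sinh_div_cosh_sq x).deriv, hξ, tanh_eq_sinh_div_cosh]
  field_simp
  linear_combination -cosh_sq x
end

section
/- For all positive integers g, m and every integer j ≥ 1, there exists a nonzero real polynomial u of degree j−1 such that the function ξ(x) = u(tanh x)/cosh x satisfies, for all x ∈ ℝ, the equation ξ''(x) − (m−1) tanh x·ξ'(x) − m tanh²x·ξ(x) + (λ_j + m − 2m/g)·ξ(x)/cosh²x = 0, where λ_j = j(j+m) + 2m/g − 2m. (The polynomial u may be taken to be the Gegenbauer polynomial C_{j−1}^{((m+2)/2)}.) -/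
open Real

open Polynomial in
/-- The Gegenbauer equation `(1 - X²) u'' - (b + 1) X u' + n (n + b) u = 0` has a polynomial
solution of degree `n`, built from a solution with parameters `n - 1`, `b + 2`. -/
lemma exists_gegenbauer_solution (n : ℕ) (b : ℝ) (hb : 0 < b) :
    ∃ u : ℝ[X], u ≠ 0 ∧ u.natDegree = n ∧
      (1 - X ^ 2) * derivative (derivative u) - C (b + 1) * X * derivative u
        + C (n * (n + b)) * u = 0 := by
  induction n generalizing b with
  | zero => exact ⟨1, one_ne_zero, natDegree_one, by simp⟩
  | succ n ih =>
    obtain ⟨v, hv0, hvn, hv⟩ := ih (b + 2) (by linarith)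
    set u : ℝ[X] := C (b + 1) * X * v - (1 - X ^ 2) * derivative v with hu
    have hc : ((n : ℝ) + 1) * (n + 1 + b) ≠ 0 := by positivity
    have hdu : derivative u = C (((n : ℝ) + 1) * (n + 1 + b)) * v := by
      simp only [hu, derivative_sub, derivative_mul, derivative_C, derivative_X, derivative_one,
        derivative_X_pow]
      simp only [map_add, map_mul, map_one, map_natCast, map_ofNat] at hv ⊢
      simp only [Nat.cast_ofNat, Nat.add_one_sub_one, pow_one]
      linear_combination -hv
    have hdu_ne : derivative u ≠ 0 := by
      rw [hdu]
      exact mul_ne_zero (C_ne_zero.mpr hc) hv0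
    have hu_deg : u.natDegree ≠ 0 := fun h => hdu_ne (derivative_of_natDegree_zero h)
    refine ⟨u, fun h => hu_deg (by simp [h]), ?_, ?_⟩
    · have h := natDegree_derivative u
      rw [hdu, natDegree_C_mul hc, hvn] at h
      omega
    · rw [hdu, derivative_C_mul, hu]
      push_cast
      ring

lemma hasDerivAt_tanh_one_sub_sq (x : ℝ) : HasDerivAt tanh (1 - tanh x ^ 2) x := by
  have hc := (cosh_pos x).ne'
  have h := (hasDerivAt_sinh x).div (hasDerivAt_cosh x) hc
  rw [show (tanh : ℝ → ℝ) = sinh / cosh from funext tanh_eq_sinh_div_cosh]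
  refine h.congr_deriv ?_
  simp only [Pi.div_apply]
  field_simp

lemma hasDerivAt_eval_tanh_div_cosh (u : Polynomial ℝ) (x : ℝ) :
    HasDerivAt (fun y : ℝ => u.eval (tanh y) / cosh y)
      (((1 - Polynomial.X ^ 2) * u.derivative - Polynomial.X * u).eval (tanh x) / cosh x) x := by
  have hc := (cosh_pos x).ne'
  have h := ((u.hasDerivAt (tanh x)).comp x (hasDerivAt_tanh_one_sub_sq x)).div
    (hasDerivAt_cosh x) hc
  refine h.congr_deriv ?_
  have hs : sinh x = tanh x * cosh x := by rw [tanh_eq_sinh_div_cosh]; field_simp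
  simp only [Polynomial.eval_sub, Polynomial.eval_mul, Polynomial.eval_pow, Polynomial.eval_X,
    Polynomial.eval_one, Function.comp_apply, hs]
  field_simp

/-- For every `j ≥ 1` there is a nonzero polynomial `u` of degree `j - 1` such that
`ξ(x) = u(tanh x)/cosh x` is an eigenfunction of the Jacobi operator of the harmonic
self-map of the sphere associated with `r(t) = (1-g)t`, with eigenvalue
`λ_j = j(j+m) + 2m/g - 2m`. -/
theorem spectrum_sphere_linear (g m : ℕ) (hg : 0 < g) (hm : 0 < m)
    (j : ℕ) (hj : 1 ≤ j) :
    ∃ u : Polynomial ℝ, u ≠ 0 ∧ u.natDegree = j - 1 ∧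
      ∀ x : ℝ,
        deriv (deriv (fun y : ℝ => u.eval (tanh y) / cosh y)) x
        - ((m : ℝ) - 1) * tanh x * deriv (fun y : ℝ => u.eval (tanh y) / cosh y) x
        - (m : ℝ) * tanh x ^ 2 * (u.eval (tanh x) / cosh x)
        + ((j * (j + (m : ℝ)) + 2 * (m : ℝ) / g - 2 * m) + (m : ℝ) - 2 * (m : ℝ) / g)
            * (u.eval (tanh x) / cosh x) / cosh x ^ 2 = 0 := by
  obtain ⟨n, rfl⟩ : ∃ n, j = n + 1 := ⟨j - 1, by omega⟩
  obtain ⟨u, hu0, hun, hu⟩ := exists_gegenbauer_solution n ((m : ℝ) + 2) (by positivity)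
  refine ⟨u, hu0, by simpa using hun, fun x => ?_⟩
  have hderiv (p : Polynomial ℝ) : deriv (fun y : ℝ => p.eval (tanh y) / cosh y) = fun y =>
      ((1 - Polynomial.X ^ 2) * p.derivative - Polynomial.X * p).eval (tanh y) / cosh y :=
    funext fun y => (hasDerivAt_eval_tanh_div_cosh p y).deriv
  have hode := congrArg (Polynomial.eval (tanh x)) hu
  have hc := (cosh_pos x).ne'
  have hw : (cosh x ^ 2)⁻¹ = 1 - tanh x ^ 2 := by
    rw [tanh_eq_sinh_div_cosh]
    field_simp
    linarith [cosh_sq x]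
  rw [hderiv, hderiv]
  simp only [Polynomial.derivative_sub, Polynomial.derivative_mul, Polynomial.derivative_one,
    Polynomial.derivative_X_pow, Polynomial.derivative_X, Polynomial.eval_sub,
    Polynomial.eval_add, Polynomial.eval_mul, Polynomial.eval_pow, Polynomial.eval_X,
    Polynomial.eval_one, Polynomial.eval_C, Polynomial.eval_zero] at hode ⊢
  rw [div_eq_mul_inv _ (cosh x ^ 2), hw]
  push_cast
  simp only [pow_one]
  linear_combination (1 - tanh x ^ 2) / cosh x * hode
end

section
/- The function r(x) = arctan(e^x) satisfies, for all x ∈ ℝ, the equation r''(x) − tanh x·r'(x) + (1/2)(1 + tanh x)·sin(2r(x)) − (1/√2)(1 − tanh x)^{3/2}·sin(r(x)) = 0. (That is, the identity map of SU(3) is an equivariant harmonic self-map.) -/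
open Real

theorem tanh_eq_exp_sq_div (x : ℝ) : tanh x = (exp x ^ 2 - 1) / (1 + exp x ^ 2) := by
  have h := exp_pos x
  rw [tanh_eq_sinh_div_cosh, sinh_eq, cosh_eq, exp_neg]
  field_simp
  ring

theorem hasDerivAt_arctan_exp (x : ℝ) :
    HasDerivAt (fun y : ℝ => arctan (exp y)) (exp x / (1 + exp x ^ 2)) x := by
  convert (hasDerivAt_exp x).arctan using 1
  ring

theorem hasDerivAt_exp_div_one_add_sq (x : ℝ) :
    HasDerivAt (fun y : ℝ => exp y / (1 + exp y ^ 2))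
      (exp x * (1 - exp x ^ 2) / (1 + exp x ^ 2) ^ 2) x := by
  have h : 1 + exp x ^ 2 ≠ 0 := by positivity
  refine ((hasDerivAt_exp x).fun_div (((hasDerivAt_exp x).fun_pow 2).const_add 1) h).congr_deriv ?_
  norm_num
  ring

theorem rpow_three_halves {a : ℝ} (ha : 0 < a) : a ^ ((3 : ℝ) / 2) = a * √a := by
  rw [show (3 : ℝ) / 2 = 1 + 1 / 2 by norm_num, rpow_add ha, rpow_one, sqrt_eq_rpow]

/-- The function `r(x) = arctan (e^x)` solves the Euler-Lagrange equation of the reduced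
energy functional for equivariant self-maps of `SU(3)`, i.e. the identity map of `SU(3)`
is an equivariant harmonic self-map. -/
theorem identity_su3_harmonic (r : ℝ → ℝ) (hr : r = fun x : ℝ => arctan (exp x)) :
    ∀ x : ℝ,
      deriv (deriv r) x - tanh x * deriv r x
      + (1 / 2) * (1 + tanh x) * sin (2 * r x)
      - (1 / Real.sqrt 2) * (1 - tanh x) ^ ((3 : ℝ) / 2) * sin (r x) = 0 := by
  intro x
  subst hr
  have hd : deriv (fun y : ℝ => arctan (exp y)) = fun y => exp y / (1 + exp y ^ 2) :=
    funext fun y => (hasDerivAt_arctan_exp y).deriv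
  have ht : 1 - tanh x = 2 / (1 + exp x ^ 2) := by
    rw [tanh_eq_exp_sq_div]
    field_simp
    ring
  rw [hd, (hasDerivAt_exp_div_one_add_sq x).deriv, ht, rpow_three_halves (by positivity),
    sqrt_div zero_le_two, sin_two_mul, sin_arctan, cos_arctan, tanh_eq_exp_sq_div]
  have hs : √(1 + exp x ^ 2) ^ 2 = 1 + exp x ^ 2 := sq_sqrt (by positivity)
  have hs0 : √(1 + exp x ^ 2) ≠ 0 := by positivity
  have h2 : √(2 : ℝ) ≠ 0 := by positivity
  generalize √(1 + exp x ^ 2) = s at hs hs0 ⊢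
  rw [← hs]
  field_simp
  rw [show exp x ^ 2 = s ^ 2 - 1 by linarith]
  ring
end
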